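/- Let α ∈ ℝ, k ∈ ℕ₀, and μ, λ ∈ ℂ satisfy Re μ + k > Re λ > -1. Then P_{λ-k}^{-μ}(tanh α) = (k! · (cosh α)^{k-λ} / (Γ(k + μ - λ) Γ(1 + λ))) · ∫_α^∞ e^{-μs} · P_k^{(μ,-μ)}(tanh s) · (sinh s - sinh α)^λ · (cosh s)^{-k} ds, with principal complex powers of positive reals. -/

import Mathlib

noncomputable def pochC (a : ℂ) (n : ℕ) : ℂ := (ascPochhammer ℂ n).eval a

/-- Ferrers function of the first kind `P_ν^μ(x)`. -/
noncomputable def ferrersP (ν μ : ℂ) (x : ℝ) : ℂ :=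
  (((1 + x) / (1 - x) : ℝ) : ℂ) ^ (μ / 2) *
    ∑' n : ℕ, pochC (-ν) n * pochC (ν + 1) n /
        (Complex.Gamma ((n : ℂ) + 1 - μ) * (n.factorial : ℂ)) *
      (((1 - x) / 2 : ℝ) : ℂ) ^ n

/-- Generalized binomial coefficient `C(z, k) = z(z-1)⋯(z-k+1)/k!`. -/
noncomputable def genBinom (z : ℂ) (k : ℕ) : ℂ :=
  (∏ i ∈ Finset.range k, (z - (i : ℂ))) / (k.factorial : ℂ)

/-- Jacobi polynomial `P_n^{(a,b)}(x)`. -/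
noncomputable def jacobiP (a b : ℂ) (n : ℕ) (x : ℝ) : ℂ :=
  (2 : ℂ) ^ (-(n : ℤ)) * ∑ j ∈ Finset.range (n + 1),
    genBinom ((n : ℂ) + a) j * genBinom ((n : ℂ) + b) (n - j) *
      ((x - 1 : ℝ) : ℂ) ^ (n - j) * ((x + 1 : ℝ) : ℂ) ^ j

theorem pochC_zero (a : ℂ) : pochC a 0 = 1 := by simp [pochC]

theorem pochC_succ (a : ℂ) (n : ℕ) : pochC a (n + 1) = pochC a n * (a + n) := by
  simp [pochC, ascPochhammer_succ_eval]

theorem pochC_succ_left (a : ℂ) (n : ℕ) : pochC a (n + 1) = a * pochC (a + 1) n := by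
  simp [pochC, ascPochhammer_succ_left, Polynomial.eval_comp]

theorem Gamma_add_nat_eq_mul_pochC {a : ℂ} (ha : 0 < a.re) (n : ℕ) :
    Complex.Gamma (a + n) = Complex.Gamma a * pochC a n := by
  induction n with
  | zero => simp [pochC_zero]
  | succ n ih =>
    have h : a + n ≠ 0 := by
      intro h
      have := congrArg Complex.re h
      simp at this
      have : (0 : ℝ) ≤ n := n.cast_nonneg
      linarith
    rw [pochC_succ, Nat.cast_succ, ← add_assoc, Complex.Gamma_add_one _ h, ih]
    ring

/-- Coefficients of the hypergeometric series of `P_ν^{-μ}`. -/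
noncomputable def ferrersCoeff (ν μ : ℂ) (n : ℕ) : ℂ :=
  pochC (-ν) n * pochC (ν + 1) n / (Complex.Gamma ((n : ℂ) + 1 + μ) * (n.factorial : ℂ))

/-- The hypergeometric series of `P_ν^{-μ}`, in the variable `z = (1 - x) / 2`. -/
noncomputable def ferrersSeries (ν μ z : ℂ) : ℂ := ∑' n : ℕ, ferrersCoeff ν μ n * z ^ n

theorem ferrersCoeff_succ_mul (ν μ : ℂ) (n : ℕ) :
    ferrersCoeff ν μ (n + 1) * ((n + 1) * (n + 1 + μ)) =
      (n - ν) * (n + ν + 1) * ferrersCoeff ν μ n := by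
  have h := Complex.one_div_Gamma_eq_self_mul_one_div_Gamma_add_one ((n : ℂ) + 1 + μ)
  have h' : (n : ℂ) + 1 + 1 + μ = (n : ℂ) + 1 + μ + 1 := by ring
  have hn : (n : ℂ) + 1 ≠ 0 := by exact_mod_cast n.succ_ne_zero
  have hf : (n.factorial : ℂ) ≠ 0 := by exact_mod_cast n.factorial_ne_zero
  simp only [ferrersCoeff, pochC_succ, h', div_eq_mul_inv, mul_inv, h, Nat.factorial_succ,
    Nat.cast_mul, Nat.cast_succ]
  field_simp
  ring

theorem summable_ferrersCoeff_mul_pow (ν μ : ℂ) {z : ℂ} (hz : ‖z‖ < 1) :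
    Summable fun n ↦ ferrersCoeff ν μ n * z ^ n := by
  obtain ⟨r, hr, hr1⟩ := exists_between hz
  refine summable_of_ratio_norm_eventually_le (r := r) hr1 ?_
  have key : ∀ c : ℂ, Filter.Tendsto (fun n : ℕ ↦ 1 + c / (n : ℂ)) Filter.atTop (nhds 1) := by
    intro c
    simpa using (tendsto_const_nhds (x := (1 : ℂ))).add (tendsto_const_div_atTop_nhds_zero_nat c)
  have lim : Filter.Tendsto (fun n : ℕ ↦
      ‖((1 + -ν / (n : ℂ)) * (1 + (ν + 1) / (n : ℂ))) /
        ((1 + 1 / (n : ℂ)) * (1 + (1 + μ) / (n : ℂ))) * z‖) Filter.atTop (nhds ‖z‖) := by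
    have := ((((key (-ν)).mul (key (ν + 1))).div ((key 1).mul (key (1 + μ)))
      (by simp)).mul_const z).norm
    simpa using this
  have hne := (key (1 + μ)).eventually_ne one_ne_zero
  filter_upwards [lim.eventually_lt_const hr, hne, Filter.eventually_gt_atTop 0] with n h1 h2 hn
  have hn' : (n : ℂ) ≠ 0 := by exact_mod_cast hn.ne'
  have hn1 : (n : ℂ) + 1 ≠ 0 := by exact_mod_cast n.succ_ne_zero
  have h3 : (n : ℂ) + 1 + μ ≠ 0 := by
    intro h
    apply h2
    field_simp
    linear_combination h
  have h4 := ferrersCoeff_succ_mul ν μ n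
  have h5 : ferrersCoeff ν μ (n + 1) * z ^ (n + 1) =
      (((1 + -ν / (n : ℂ)) * (1 + (ν + 1) / (n : ℂ))) /
        ((1 + 1 / (n : ℂ)) * (1 + (1 + μ) / (n : ℂ))) * z) * (ferrersCoeff ν μ n * z ^ n) := by
    have e : ((1 + -ν / (n : ℂ)) * (1 + (ν + 1) / (n : ℂ))) /
        ((1 + 1 / (n : ℂ)) * (1 + (1 + μ) / (n : ℂ))) =
        ((n - ν) * (n + ν + 1)) / ((n + 1) * (n + 1 + μ)) := by
      rw [div_eq_div_iff (mul_ne_zero (by field_simp; exact div_ne_zero hn1 hn') h2)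
        (mul_ne_zero hn1 h3)]
      field_simp
      ring
    have e2 : ferrersCoeff ν μ (n + 1) =
        ((n - ν) * (n + ν + 1)) / ((n + 1) * (n + 1 + μ)) * ferrersCoeff ν μ n := by
      rw [div_mul_eq_mul_div, eq_div_iff (mul_ne_zero hn1 h3)]
      exact h4
    rw [e, e2]
    ring
  rw [h5, norm_mul]
  gcongr

theorem hasSum_ferrersCoeff_succ_mul_pow (ν μ : ℂ) {z : ℂ} (hz : ‖z‖ < 1) :
    HasSum (fun n ↦ ferrersCoeff ν μ (n + 1) * z ^ (n + 1))
      (ferrersSeries ν μ z - ferrersCoeff ν μ 0) := by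
  have h := (summable_ferrersCoeff_mul_pow ν μ hz).hasSum
  rw [← hasSum_nat_add_iff' 1] at h
  simpa [ferrersSeries] using h

theorem hasSum_mul_ferrersSeries (ν μ : ℂ) {z : ℂ} (hz : ‖z‖ < 1) :
    HasSum (fun n ↦ ferrersCoeff ν μ n * z ^ (n + 1)) (z * ferrersSeries ν μ z) := by
  have h := (summable_ferrersCoeff_mul_pow ν μ hz).hasSum.mul_left z
  convert! h using 2 with n
  ring

/-- Contiguous relation lowering the order. -/
theorem ferrersSeries_order_sub_one (ν μ : ℂ) {z : ℂ} (hz : ‖z‖ < 1) :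
    2 * (1 - z) * ferrersSeries ν (μ - 1) z =
      (1 - 2 * z) * (μ - ν - 1) * ferrersSeries ν μ z +
        (ν + 1 + μ) * ferrersSeries (ν + 1) μ z := by
  have H1 := (((hasSum_ferrersCoeff_succ_mul_pow ν (μ - 1) hz).sub
    (hasSum_mul_ferrersSeries ν (μ - 1) hz)).mul_left 2)
  have H2 := (((hasSum_ferrersCoeff_succ_mul_pow ν μ hz).sub
    ((hasSum_mul_ferrersSeries ν μ hz).mul_left 2)).mul_left (μ - ν - 1)).add
    ((hasSum_ferrersCoeff_succ_mul_pow (ν + 1) μ hz).mul_left (ν + 1 + μ))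
  have H : ∀ n : ℕ, 2 * (ferrersCoeff ν (μ - 1) (n + 1) * z ^ (n + 1) -
      ferrersCoeff ν (μ - 1) n * z ^ (n + 1)) =
      (μ - ν - 1) * (ferrersCoeff ν μ (n + 1) * z ^ (n + 1) -
        2 * (ferrersCoeff ν μ n * z ^ (n + 1))) +
      (ν + 1 + μ) * (ferrersCoeff (ν + 1) μ (n + 1) * z ^ (n + 1)) := by
    intro n
    have hn1 : (n : ℂ) + 1 ≠ 0 := by exact_mod_cast n.succ_ne_zero
    have hf : (n.factorial : ℂ) ≠ 0 := by exact_mod_cast n.factorial_ne_zero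
    have g1 := Complex.one_div_Gamma_eq_self_mul_one_div_Gamma_add_one ((n : ℂ) + 1 + μ)
    have g2 := Complex.one_div_Gamma_eq_self_mul_one_div_Gamma_add_one ((n : ℂ) + μ)
    have e1 : (n : ℂ) + 1 + 1 + μ = (n : ℂ) + 1 + μ + 1 := by ring
    have e2 : (n : ℂ) + 1 + 1 + (μ - 1) = (n : ℂ) + 1 + μ := by ring
    have e3 : (n : ℂ) + 1 + (μ - 1) = (n : ℂ) + μ := by ring
    have e4 : (n : ℂ) + μ + 1 = (n : ℂ) + 1 + μ := by ring
    have p1 : pochC (-(ν + 1)) (n + 1) = -(ν + 1) * pochC (-ν) n := by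
      rw [pochC_succ_left]; ring_nf
    have p2 : (ν + 1) * pochC (ν + 1 + 1) n = pochC (ν + 1) n * (ν + 1 + n) := by
      rw [← pochC_succ_left, pochC_succ]
    simp only [ferrersCoeff, e1, e2, e3, div_eq_mul_inv, mul_inv, g2, e4, g1, p1,
      Nat.factorial_succ, Nat.cast_mul, Nat.cast_succ]
    rw [pochC_succ (ν + 1 + 1), pochC_succ (-ν), pochC_succ (ν + 1)]
    generalize pochC (ν + 1 + 1) n = W at *
    generalize pochC (ν + 1) n = Z at *
    generalize pochC (-ν) n = X at *
    generalize (Complex.Gamma (n + 1 + μ + 1))⁻¹ = G at *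
    field_simp
    linear_combination (X * G * z ^ (n + 1) * (ν + 1 + μ) * (ν + 1 + 1 + n)) * p2
  have h0 : 2 * ferrersCoeff ν (μ - 1) 0 =
      (μ - ν - 1) * ferrersCoeff ν μ 0 + (ν + 1 + μ) * ferrersCoeff (ν + 1) μ 0 := by
    have g := Complex.one_div_Gamma_eq_self_mul_one_div_Gamma_add_one μ
    simp only [ferrersCoeff, pochC_zero, Nat.cast_zero, Nat.factorial_zero, Nat.cast_one, zero_add,
      add_sub_cancel, mul_one, one_div, g, add_comm 1 μ]
    ring
  have := H1.unique ((funext H) ▸ H2)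
  linear_combination this + h0

theorem genBinom_zero (z : ℂ) : genBinom z 0 = 1 := by simp [genBinom]

theorem genBinom_succ (z : ℂ) (j : ℕ) :
    genBinom z (j + 1) = genBinom z j * (z - j) / (j + 1) := by
  have hn : (j : ℂ) + 1 ≠ 0 := by exact_mod_cast j.succ_ne_zero
  have hf : (j.factorial : ℂ) ≠ 0 := by exact_mod_cast j.factorial_ne_zero
  simp only [genBinom, Finset.prod_range_succ, Nat.factorial_succ, Nat.cast_mul, Nat.cast_succ]
  field_simp

theorem genBinom_add_one_succ (z : ℂ) (j : ℕ) :
    genBinom (z + 1) (j + 1) = genBinom z j * (z + 1) / (j + 1) := by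
  have hn : (j : ℂ) + 1 ≠ 0 := by exact_mod_cast j.succ_ne_zero
  have hf : (j.factorial : ℂ) ≠ 0 := by exact_mod_cast j.factorial_ne_zero
  simp only [genBinom, Finset.prod_range_succ', Nat.factorial_succ, Nat.cast_mul, Nat.cast_succ,
    Nat.cast_zero, sub_zero, add_sub_add_right_eq_sub]
  field_simp

theorem jacobiP_eq_sum_antidiagonal (μ : ℂ) (k : ℕ) (x : ℝ) :
    jacobiP μ (-μ) k x = ∑ p ∈ Finset.HasAntidiagonal.antidiagonal k,
      genBinom (k + μ) p.1 * genBinom (k - μ) p.2 *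
        ((((x : ℂ) - 1) / 2) ^ p.2 * (((x : ℂ) + 1) / 2) ^ p.1) := by
  rw [Finset.Nat.sum_antidiagonal_eq_sum_range_succ
    (fun j i ↦ genBinom (k + μ) j * genBinom (k - μ) i *
        ((((x : ℂ) - 1) / 2) ^ i * (((x : ℂ) + 1) / 2) ^ j)), jacobiP, Finset.mul_sum]
  refine Finset.sum_congr rfl fun j hj ↦ ?_
  have hj' : j ≤ k := Nat.lt_succ_iff.mp (Finset.mem_range.mp hj)
  have h2 : (2 : ℂ) ^ (-(k : ℤ)) = (2 ^ (k - j))⁻¹ * (2 ^ j)⁻¹ := by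
    rw [zpow_neg, zpow_natCast, ← mul_inv, ← pow_add, Nat.sub_add_cancel hj']
  rw [h2, div_pow, div_pow]
  push_cast
  rw [← sub_eq_add_neg]
  ring

/-- Coefficient form of the differential recurrence of `jacobiP μ (-μ)`. -/
theorem succ_mul_sum_antidiagonal_genBinom (μ a b : ℂ) (k : ℕ) :
    (k + 1) * ∑ p ∈ Finset.HasAntidiagonal.antidiagonal (k + 1),
      genBinom ((k + 1 : ℕ) + μ) p.1 * genBinom ((k + 1 : ℕ) - μ) p.2 * (a ^ p.2 * b ^ p.1) =
    ∑ p ∈ Finset.HasAntidiagonal.antidiagonal k, genBinom (k + μ) p.1 * genBinom (k - μ) p.2 *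
      (a ^ p.2 * b ^ (p.1 + 1) * (μ + k + 1 + 2 * p.2) +
        a ^ (p.2 + 1) * b ^ p.1 * (-μ + k + 1 + 2 * p.1)) := by
  set f : ℕ × ℕ → ℂ := fun p ↦ if p.1 = 0 then 0 else
    genBinom (k + μ) (p.1 - 1) * genBinom (k - μ) p.2 *
      (a ^ p.2 * b ^ p.1 * (μ + k + 1 + 2 * p.2)) with hf
  set g : ℕ × ℕ → ℂ := fun p ↦ if p.2 = 0 then 0 else
    genBinom (k + μ) p.1 * genBinom (k - μ) (p.2 - 1) *
      (a ^ p.2 * b ^ p.1 * (-μ + k + 1 + 2 * p.1)) with hg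
  have h1 : ∑ p ∈ Finset.HasAntidiagonal.antidiagonal (k + 1), f p =
      ∑ p ∈ Finset.HasAntidiagonal.antidiagonal k, genBinom (k + μ) p.1 * genBinom (k - μ) p.2 *
        (a ^ p.2 * b ^ (p.1 + 1) * (μ + k + 1 + 2 * p.2)) := by
    rw [Finset.Nat.sum_antidiagonal_succ]
    simp [hf]
  have h2 : ∑ p ∈ Finset.HasAntidiagonal.antidiagonal (k + 1), g p =
      ∑ p ∈ Finset.HasAntidiagonal.antidiagonal k, genBinom (k + μ) p.1 * genBinom (k - μ) p.2 *
        (a ^ (p.2 + 1) * b ^ p.1 * (-μ + k + 1 + 2 * p.1)) := by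
    rw [Finset.Nat.sum_antidiagonal_succ']
    simp [hg]
  simp only [mul_add (genBinom _ _ * genBinom _ _), Finset.sum_add_distrib]
  rw [← h1, ← h2, ← Finset.sum_add_distrib, Finset.mul_sum]
  refine Finset.sum_congr rfl fun p hp ↦ ?_
  obtain ⟨j, i⟩ := p
  have hij : j + i = k + 1 := Finset.HasAntidiagonal.mem_antidiagonal.mp hp
  have c1 : ((k + 1 : ℕ) : ℂ) + μ = k + μ + 1 := by push_cast; ring
  have c2 : ((k + 1 : ℕ) : ℂ) - μ = k - μ + 1 := by push_cast; ring
  simp only [hf, hg, c1, c2]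
  rcases j with _ | j <;> rcases i with _ | i
  · omega
  · obtain rfl : i = k := by omega
    have hn : (i : ℂ) + 1 ≠ 0 := by exact_mod_cast i.succ_ne_zero
    simp [genBinom_zero, genBinom_add_one_succ]
    field_simp
    ring
  · obtain rfl : j = k := by omega
    have hn : (j : ℂ) + 1 ≠ 0 := by exact_mod_cast j.succ_ne_zero
    simp [genBinom_zero, genBinom_add_one_succ]
    field_simp
    ring
  · obtain rfl : k = j + i + 1 := by omega
    have hi : (i : ℂ) + 1 ≠ 0 := by exact_mod_cast i.succ_ne_zero
    have hj : (j : ℂ) + 1 ≠ 0 := by exact_mod_cast j.succ_ne_zero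
    simp only [genBinom_add_one_succ, Nat.succ_ne_zero, if_false, Nat.add_sub_cancel]
    simp only [genBinom_succ]
    push_cast
    field_simp
    ring

/-- The kernel of the integral representation, divided by `cosh`. -/
noncomputable def jacobiKernel (μ : ℂ) (k : ℕ) (s : ℝ) : ℂ :=
  (-1) ^ k * k.factorial * Complex.exp (-μ * s) * jacobiP μ (-μ) k (Real.tanh s) /
    ((Real.cosh s : ℝ) : ℂ) ^ (k + 1)

theorem hasDerivAt_ofReal_cosh (s : ℝ) :
    HasDerivAt (fun s : ℝ ↦ ((Real.cosh s : ℝ) : ℂ)) ((Real.sinh s : ℝ) : ℂ) s :=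
  (Real.hasDerivAt_cosh s).ofReal_comp

theorem hasDerivAt_ofReal_sinh (s : ℝ) :
    HasDerivAt (fun s : ℝ ↦ ((Real.sinh s : ℝ) : ℂ)) ((Real.cosh s : ℝ) : ℂ) s :=
  (Real.hasDerivAt_sinh s).ofReal_comp

theorem ofReal_cosh_ne_zero (s : ℝ) : ((Real.cosh s : ℝ) : ℂ) ≠ 0 := by
  exact_mod_cast (Real.cosh_pos s).ne'

theorem ofReal_cosh_sq (s : ℝ) :
    ((Real.cosh s : ℝ) : ℂ) ^ 2 = ((Real.sinh s : ℝ) : ℂ) ^ 2 + 1 := by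
  exact_mod_cast Real.cosh_sq s

theorem hasDerivAt_ofReal_tanh (s : ℝ) :
    HasDerivAt (fun s : ℝ ↦ ((Real.tanh s : ℝ) : ℂ)) (1 - ((Real.tanh s : ℝ) : ℂ) ^ 2) s := by
  have h := (hasDerivAt_ofReal_sinh s).div (hasDerivAt_ofReal_cosh s) (ofReal_cosh_ne_zero s)
  have hc := ofReal_cosh_ne_zero s
  convert! h using 1
  · ext t
    simp [Real.tanh_eq_sinh_div_cosh]
  · rw [Real.tanh_eq_sinh_div_cosh]
    push_cast at *
    field_simp

theorem hasDerivAt_exp_neg_mul (μ : ℂ) (s : ℝ) :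
    HasDerivAt (fun s : ℝ ↦ Complex.exp (-μ * s)) (-μ * Complex.exp (-μ * s)) s := by
  have h := ((hasDerivAt_id s).ofReal_comp.const_mul (-μ)).cexp
  simpa [mul_comm] using h

theorem HasDerivAt.pow_mul_pow_of_riccati {a b : ℝ → ℂ} {s : ℝ}
    (ha : HasDerivAt a (-2 * (a s * b s)) s) (hb : HasDerivAt b (-2 * (a s * b s)) s) (i j : ℕ) :
    HasDerivAt (fun t ↦ a t ^ i * b t ^ j)
      (-2 * (i * (a s ^ i * b s ^ (j + 1)) + j * (a s ^ (i + 1) * b s ^ j))) s := by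
  have h := (ha.fun_pow i).fun_mul (hb.fun_pow j)
  convert! h using 1
  rcases i with _ | i <;> rcases j with _ | j <;> simp <;> ring

theorem hasDerivAt_jacobiP_tanh (μ : ℂ) (k : ℕ) (s : ℝ) :
    HasDerivAt (fun t : ℝ ↦ jacobiP μ (-μ) k (Real.tanh t))
      ((μ + (k + 1) * ((Real.tanh s : ℝ) : ℂ)) * jacobiP μ (-μ) k (Real.tanh s) -
        (k + 1) * jacobiP μ (-μ) (k + 1) (Real.tanh s)) s := by
  have hT := hasDerivAt_ofReal_tanh s
  set a : ℝ → ℂ := fun t ↦ (((Real.tanh t : ℝ) : ℂ) - 1) / 2 with ha_def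
  set b : ℝ → ℂ := fun t ↦ (((Real.tanh t : ℝ) : ℂ) + 1) / 2 with hb_def
  have ha : HasDerivAt a (-2 * (a s * b s)) s :=
    ((hT.sub_const 1).div_const 2).congr_deriv (by simp only [ha_def, hb_def]; ring)
  have hb : HasDerivAt b (-2 * (a s * b s)) s :=
    ((hT.add_const 1).div_const 2).congr_deriv (by simp only [ha_def, hb_def]; ring)
  have hP : ∀ (l : ℕ) (t : ℝ), jacobiP μ (-μ) l (Real.tanh t) =
      ∑ p ∈ Finset.HasAntidiagonal.antidiagonal l,
        genBinom (l + μ) p.1 * genBinom (l - μ) p.2 * (a t ^ p.2 * b t ^ p.1) :=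
    fun l t ↦ jacobiP_eq_sum_antidiagonal μ l _
  have hab : ((Real.tanh s : ℝ) : ℂ) = a s + b s := by simp only [ha_def, hb_def]; ring
  have hba : b s = a s + 1 := by simp only [ha_def, hb_def]; ring
  clear_value a b
  have hS := HasDerivAt.fun_sum (u := Finset.HasAntidiagonal.antidiagonal k) fun p _ ↦
    ((ha.pow_mul_pow_of_riccati hb p.2 p.1).const_mul
      (genBinom (k + μ) p.1 * genBinom (k - μ) p.2))
  simp only [hP]
  refine hS.congr_deriv ?_
  rw [succ_mul_sum_antidiagonal_genBinom, Finset.mul_sum, ← Finset.sum_sub_distrib, hab]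
  refine Finset.sum_congr rfl fun p _ ↦ ?_
  rw [hba]
  ring

theorem hasDerivAt_jacobiKernel (μ : ℂ) (k : ℕ) (s : ℝ) :
    HasDerivAt (jacobiKernel μ k) (((Real.cosh s : ℝ) : ℂ) * jacobiKernel μ (k + 1) s) s := by
  have hc := ofReal_cosh_ne_zero s
  have hTc : ((Real.sinh s : ℝ) : ℂ) = ((Real.tanh s : ℝ) : ℂ) * ((Real.cosh s : ℝ) : ℂ) := by
    rw [Real.tanh_eq_sinh_div_cosh]
    push_cast at *
    field_simp
  have hG := (((hasDerivAt_exp_neg_mul μ s).const_mul ((-1) ^ k * (k.factorial : ℂ))).fun_mul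
    (hasDerivAt_jacobiP_tanh μ k s)).fun_div ((hasDerivAt_ofReal_cosh s).fun_pow (k + 1))
      (pow_ne_zero _ hc)
  refine hG.congr_deriv ?_
  rw [hTc]
  simp only [jacobiKernel, Nat.factorial_succ, Nat.cast_mul, Nat.cast_succ, Nat.add_sub_cancel]
  generalize ((Real.cosh s : ℝ) : ℂ) = C at *
  generalize jacobiP μ (-μ) k (Real.tanh s) = P at *
  generalize jacobiP μ (-μ) (k + 1) (Real.tanh s) = Q at *
  generalize ((Real.tanh s : ℝ) : ℂ) = T at *
  field_simp
  ring

theorem jacobiKernel_zero (μ : ℂ) (s : ℝ) :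
    jacobiKernel μ 0 s = Complex.exp (-μ * s) / ((Real.cosh s : ℝ) : ℂ) := by
  simp [jacobiKernel, jacobiP, genBinom]

theorem jacobiKernel_one (μ : ℂ) (s : ℝ) :
    jacobiKernel μ 1 s = -Complex.exp (-μ * s) *
      (μ * ((Real.cosh s : ℝ) : ℂ) + ((Real.sinh s : ℝ) : ℂ)) / ((Real.cosh s : ℝ) : ℂ) ^ 3 := by
  have hc := ofReal_cosh_ne_zero s
  simp [jacobiKernel, jacobiP, genBinom, Finset.sum_range_succ, Real.tanh_eq_sinh_div_cosh] at hc ⊢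
  field_simp
  ring

theorem exp_neg_sub_one_mul (μ : ℂ) (s : ℝ) : Complex.exp (-(μ - 1) * s) =
    Complex.exp (-μ * s) * (((Real.cosh s : ℝ) : ℂ) + ((Real.sinh s : ℝ) : ℂ)) := by
  rw [← Complex.ofReal_add, Real.cosh_add_sinh, Complex.ofReal_exp, ← Complex.exp_add]
  ring_nf

theorem exp_neg_add_one_mul (μ : ℂ) (s : ℝ) : Complex.exp (-(μ + 1) * s) =
    Complex.exp (-μ * s) * (((Real.cosh s : ℝ) : ℂ) - ((Real.sinh s : ℝ) : ℂ)) := by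
  rw [← Complex.ofReal_sub, Real.cosh_sub_sinh, Complex.ofReal_exp, ← Complex.exp_add]
  push_cast
  ring_nf

theorem jacobiKernel_order_sub_one (μ : ℂ) (k : ℕ) (s : ℝ) :
    jacobiKernel (μ - 1) (k + 1) s =
      ((Real.sinh s : ℝ) : ℂ) * jacobiKernel μ (k + 1) s + (k + 1 - μ) * jacobiKernel μ k s := by
  induction k generalizing s with
  | zero =>
    have hc := ofReal_cosh_ne_zero s
    simp only [zero_add, jacobiKernel_zero, jacobiKernel_one, exp_neg_sub_one_mul]
    have h := ofReal_cosh_sq s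
    field_simp
    push_cast
    ring
  | succ k ih =>
    have h1 := hasDerivAt_jacobiKernel (μ - 1) (k + 1) s
    have h2 := ((hasDerivAt_ofReal_sinh s).mul (hasDerivAt_jacobiKernel μ (k + 1) s)).add
      ((hasDerivAt_jacobiKernel μ k s).const_mul (k + 1 - μ))
    have h3 := h1.unique (h2.congr_of_eventuallyEq (Filter.Eventually.of_forall ih))
    apply mul_left_cancel₀ (ofReal_cosh_ne_zero s)
    rw [h3]
    push_cast
    ring

theorem jacobiKernel_order_add_one (μ : ℂ) (k : ℕ) (s : ℝ) :
    jacobiKernel (μ + 1) (k + 1) s =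
      -(((Real.sinh s : ℝ) : ℂ) * jacobiKernel μ (k + 1) s) - (k + 1 + μ) * jacobiKernel μ k s := by
  induction k generalizing s with
  | zero =>
    have hc := ofReal_cosh_ne_zero s
    simp only [zero_add, jacobiKernel_zero, jacobiKernel_one, exp_neg_add_one_mul]
    have h := ofReal_cosh_sq s
    field_simp
    push_cast
    ring
  | succ k ih =>
    have h1 := hasDerivAt_jacobiKernel (μ + 1) (k + 1) s
    have h2 := ((hasDerivAt_ofReal_sinh s).mul (hasDerivAt_jacobiKernel μ (k + 1) s)).neg.sub
      ((hasDerivAt_jacobiKernel μ k s).const_mul (k + 1 + μ))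
    have h3 := h1.unique (h2.congr_of_eventuallyEq (Filter.Eventually.of_forall ih))
    apply mul_left_cancel₀ (ofReal_cosh_ne_zero s)
    rw [h3]
    push_cast
    ring

open MeasureTheory in
/-- Euler's beta integral after the substitution `t = exp (α - s)`. -/
theorem integrableOn_beta_exp {a b : ℂ} (α : ℝ) (ha : 0 < a.re) (hb : 0 < b.re) :
    IntegrableOn (fun s : ℝ ↦ Complex.exp (a * (α - s)) *
        ((1 - Real.exp (α - s) : ℝ) : ℂ) ^ (b - 1)) (Set.Ioi α) ∧
      ∫ s in Set.Ioi α, Complex.exp (a * (α - s)) *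
        ((1 - Real.exp (α - s) : ℝ) : ℂ) ^ (b - 1) = Complex.betaIntegral a b := by
  have hd : ∀ s ∈ Set.Ioi α, HasDerivWithinAt (fun s : ℝ ↦ Real.exp (α - s))
      (-Real.exp (α - s)) (Set.Ioi α) s := by
    intro s _
    have := ((hasDerivAt_id s).const_sub α).exp
    simpa using this.hasDerivWithinAt
  have hinj : Set.InjOn (fun s : ℝ ↦ Real.exp (α - s)) (Set.Ioi α) := by
    intro s _ t _ h
    have := Real.exp_injective h
    linarith
  have himg : (fun s : ℝ ↦ Real.exp (α - s)) '' Set.Ioi α = Set.Ioo 0 1 := by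
    ext t
    constructor
    · rintro ⟨s, hs, rfl⟩
      exact ⟨Real.exp_pos _, by simpa using hs⟩
    · rintro ⟨h0, h1⟩
      refine ⟨α - Real.log t, ?_, ?_⟩
      · have := Real.log_neg h0 h1
        simp only [Set.mem_Ioi]
        linarith
      · simp [Real.exp_log h0]
  have heq : ∀ s : ℝ, |(-Real.exp (α - s))| • (((Real.exp (α - s) : ℝ) : ℂ) ^ (a - 1) *
      (1 - ((Real.exp (α - s) : ℝ) : ℂ)) ^ (b - 1)) =
      Complex.exp (a * (α - s)) * ((1 - Real.exp (α - s) : ℝ) : ℂ) ^ (b - 1) := by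
    intro s
    rw [abs_neg, abs_of_pos (Real.exp_pos _), Complex.real_smul, ← mul_assoc]
    push_cast
    congr 1
    rw [Complex.cpow_def_of_ne_zero (Complex.exp_ne_zero _), ← Complex.ofReal_sub,
      ← Complex.ofReal_exp, ← Complex.ofReal_log (Real.exp_pos _).le, Real.log_exp,
      Complex.ofReal_exp, ← Complex.exp_add]
    ring_nf
  have h1 := integrableOn_image_iff_integrableOn_abs_deriv_smul measurableSet_Ioi hd hinj
    (fun t : ℝ ↦ (t : ℂ) ^ (a - 1) * (1 - (t : ℂ)) ^ (b - 1))
  have h2 := integral_image_eq_integral_abs_deriv_smul measurableSet_Ioi hd hinj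
    (fun t : ℝ ↦ (t : ℂ) ^ (a - 1) * (1 - (t : ℂ)) ^ (b - 1))
  simp only [himg, heq] at h1 h2
  refine ⟨h1.mp ?_, ?_⟩
  · have := Complex.betaIntegral_convergent ha hb
    rw [intervalIntegrable_iff_integrableOn_Ioo_of_le zero_le_one] at this
    exact this
  · rw [← h2, Complex.betaIntegral, intervalIntegral.integral_of_le zero_le_one,
      integral_Ioc_eq_integral_Ioo]

theorem hasSum_one_sub_cpow_neg (a : ℂ) {z : ℂ} (hz : ‖z‖ < 1) :
    HasSum (fun n : ℕ ↦ pochC (-a) n / n.factorial * z ^ n) ((1 - z) ^ a) := by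
  have h := (Complex.one_div_one_sub_cpow_hasFPowerSeriesOnBall_zero (-a)).hasSum (y := z)
    (by simpa [Metric.mem_eball, edist_zero_right, enorm_eq_nnnorm, ← NNReal.coe_lt_coe] using hz)
  simp only [zero_add, Complex.cpow_neg, one_div, inv_inv] at h
  convert! h using 2 with n
  have hf : (n.factorial : ℂ) ≠ 0 := by exact_mod_cast n.factorial_ne_zero
  have h1 := Ring.factorial_nsmul_multichoose_eq_ascPochhammer (-a) n
  rw [Polynomial.ascPochhammer_smeval_eq_eval, nsmul_eq_mul] at h1
  rw [FormalMultilinearSeries.ofScalars_apply_eq, Ring.choose, pochC, ← h1, smul_eq_mul,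
    show -a + (n : ℂ) - 1 - n + 1 = -a by ring]
  field_simp

theorem pochC_neg_div_factorial {a : ℂ} (ha : -1 < a.re) (n : ℕ) :
    pochC (-a) n / n.factorial = Complex.Gamma (a + 1) * ferrersCoeff a a n := by
  have ha' : 0 < (a + 1).re := by simp; linarith
  have h := Gamma_add_nat_eq_mul_pochC ha' n
  have h0 : Complex.Gamma (a + 1 + n) ≠ 0 := Complex.Gamma_ne_zero_of_re_pos (by
    simp; have : (0 : ℝ) ≤ n := n.cast_nonneg
    linarith)
  have hG : Complex.Gamma (a + 1) ≠ 0 := left_ne_zero_of_mul (h ▸ h0)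
  have hp : pochC (a + 1) n ≠ 0 := right_ne_zero_of_mul (h ▸ h0)
  have hf : (n.factorial : ℂ) ≠ 0 := by exact_mod_cast n.factorial_ne_zero
  rw [ferrersCoeff, show (n : ℂ) + 1 + a = a + 1 + n by ring, h]
  field_simp

theorem one_sub_tanh_div_two (α : ℝ) :
    (1 - Real.tanh α) / 2 = Real.exp (-α) / (2 * Real.cosh α) := by
  have := (Real.cosh_pos α).ne'
  rw [Real.tanh_eq_sinh_div_cosh, ← Real.cosh_sub_sinh]
  field_simp

theorem one_sub_tanh_div_two_mem_Ioo (α : ℝ) : (1 - Real.tanh α) / 2 ∈ Set.Ioo (0 : ℝ) 1 := by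
  have h1 := Real.tanh_lt_one α
  have h2 := Real.neg_one_lt_tanh α
  constructor <;> linarith

theorem norm_one_sub_tanh_div_two_lt_one (α : ℝ) :
    ‖(((1 - Real.tanh α) / 2 : ℝ) : ℂ)‖ < 1 := by
  obtain ⟨h1, h2⟩ := one_sub_tanh_div_two_mem_Ioo α
  rwa [Complex.norm_real, Real.norm_of_nonneg h1.le]

theorem sinh_sub_sinh_eq_mul (α s : ℝ) :
    Real.sinh s - Real.sinh α = Real.cosh α * Real.exp (s - α) * (1 - Real.exp (α - s)) *
      (1 - (1 - Real.exp (α - s)) * ((1 - Real.tanh α) / 2)) := by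
  rw [one_sub_tanh_div_two]
  have hc := (Real.cosh_pos α).ne'
  field_simp
  simp only [Real.sinh_eq, Real.cosh_eq, sub_eq_add_neg, Real.exp_add, Real.exp_neg]
  field_simp
  ring

theorem one_sub_exp_mem_Ioo {α s : ℝ} (hs : α < s) : 1 - Real.exp (α - s) ∈ Set.Ioo (0 : ℝ) 1 := by
  have h1 := Real.exp_pos (α - s)
  have h2 : Real.exp (α - s) < 1 := by simpa using hs
  constructor <;> linarith

theorem one_sub_mul_one_sub_tanh_mem_Ioc {α s : ℝ} (hs : α < s) :
    (1 + Real.tanh α) / 2 ≤ 1 - (1 - Real.exp (α - s)) * ((1 - Real.tanh α) / 2) ∧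
      1 - (1 - Real.exp (α - s)) * ((1 - Real.tanh α) / 2) ≤ 1 := by
  obtain ⟨h1, h2⟩ := one_sub_exp_mem_Ioo hs
  obtain ⟨h3, h4⟩ := one_sub_tanh_div_two_mem_Ioo α
  constructor <;> nlinarith

theorem sinh_sub_sinh_cpow {α s : ℝ} (hs : α < s) (a : ℂ) :
    ((Real.sinh s - Real.sinh α : ℝ) : ℂ) ^ a =
      ((Real.cosh α : ℝ) : ℂ) ^ a * Complex.exp (-a * (α - s)) *
        ((1 - Real.exp (α - s) : ℝ) : ℂ) ^ a *
        ((1 - (1 - Real.exp (α - s)) * ((1 - Real.tanh α) / 2) : ℝ) : ℂ) ^ a := by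
  have h1 := (one_sub_exp_mem_Ioo hs).1.le
  have h2 := (one_sub_mul_one_sub_tanh_mem_Ioc hs).1
  have h3 := Real.neg_one_lt_tanh α
  have h4 := (Real.cosh_pos α).le
  have h5 := (Real.exp_pos (s - α)).le
  rw [sinh_sub_sinh_eq_mul, Complex.ofReal_mul, Complex.ofReal_mul, Complex.ofReal_mul,
    ← Complex.ofReal_mul (Real.cosh α), ← Complex.ofReal_mul,
    Complex.mul_cpow_ofReal_nonneg (by positivity) (by linarith), Complex.ofReal_mul,
    Complex.mul_cpow_ofReal_nonneg (by positivity) h1, Complex.ofReal_mul,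
    Complex.mul_cpow_ofReal_nonneg h4 h5]
  congr 3
  rw [Complex.cpow_def_of_ne_zero (by exact_mod_cast (Real.exp_pos _).ne'),
    ← Complex.ofReal_log h5, Real.log_exp]
  push_cast
  ring_nf

theorem measurable_beta_exp (a b : ℂ) (α : ℝ) :
    Measurable fun s : ℝ ↦ Complex.exp (a * (α - s)) *
        ((1 - Real.exp (α - s) : ℝ) : ℂ) ^ b := by
  fun_prop

open MeasureTheory in
theorem integral_exp_mul_sinh_sub_sinh_cpow {μ a : ℂ} (α : ℝ) (h1 : a.re < μ.re)
    (h2 : -1 < a.re) :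
    ∫ s in Set.Ioi α, Complex.exp (-μ * s) * ((Real.sinh s - Real.sinh α : ℝ) : ℂ) ^ a =
      Complex.Gamma (1 + a) * ((Real.cosh α : ℝ) : ℂ) ^ a * Complex.Gamma (μ - a) *
        Complex.exp (-μ * α) * ferrersSeries a μ (((1 - Real.tanh α) / 2 : ℝ) : ℂ) := by
  set z : ℂ := (((1 - Real.tanh α) / 2 : ℝ) : ℂ) with hz_def
  have hz : ‖z‖ < 1 := norm_one_sub_tanh_div_two_lt_one α
  set K : ℂ := Complex.exp (-μ * α) * ((Real.cosh α : ℝ) : ℂ) ^ a with hK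
  have hra : 0 < (μ - a).re := by simp; linarith
  have hrb : ∀ n : ℕ, 0 < (a + 1 + n).re := fun n ↦ by
    simp
    have : (0 : ℝ) ≤ n := n.cast_nonneg
    linarith
  have hbase := (integrableOn_beta_exp α hra (by simpa using hrb 0 : 0 < (a + 1).re)).1
  simp only [add_sub_cancel_right] at hbase
  set c : ℕ → ℂ := fun n ↦ pochC (-a) n / n.factorial * z ^ n with hc
  have hcs : Summable fun n ↦ ‖c n‖ := by
    have := ((summable_ferrersCoeff_mul_pow a a hz).mul_left (Complex.Gamma (a + 1))).norm
    refine this.congr fun n ↦ ?_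
    rw [hc]
    simp only [pochC_neg_div_factorial h2, mul_assoc]
  set B : ℝ → ℂ := fun s ↦ Complex.exp ((μ - a) * (α - s)) *
    ((1 - Real.exp (α - s) : ℝ) : ℂ) ^ a with hB
  have hBm : Measurable B := measurable_beta_exp _ _ _
  have hsum : HasSum (fun n ↦ ∫ s in Set.Ioi α, c n * (B s * ((1 - Real.exp (α - s) : ℝ) : ℂ) ^ n))
      (∫ s in Set.Ioi α, B s *
        ((1 - (1 - Real.exp (α - s)) * ((1 - Real.tanh α) / 2) : ℝ) : ℂ) ^ a) := by
    refine hasSum_integral_of_dominated_convergence (fun n s ↦ ‖c n‖ * ‖B s‖) ?_ ?_ ?_ ?_ ?_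
    · intro n
      refine Measurable.aestronglyMeasurable ?_
      fun_prop
    · intro n
      refine (ae_restrict_mem measurableSet_Ioi).mono fun s hs ↦ ?_
      obtain ⟨h3, h4⟩ := one_sub_exp_mem_Ioo hs
      rw [norm_mul (c n), norm_mul (B s), norm_pow, Complex.norm_real, Real.norm_of_nonneg h3.le]
      gcongr
      exact mul_le_of_le_one_right (norm_nonneg _) (pow_le_one₀ h3.le h4.le)
    · exact Filter.Eventually.of_forall fun s ↦ hcs.mul_right _
    · simp only [tsum_mul_right]
      exact (hbase.norm).const_mul _
    · refine (ae_restrict_mem measurableSet_Ioi).mono fun s hs ↦ ?_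
      obtain ⟨h3, h4⟩ := one_sub_exp_mem_Ioo hs
      have hlt : ‖((1 - Real.exp (α - s) : ℝ) : ℂ) * z‖ < 1 := by
        rw [norm_mul, Complex.norm_real, Real.norm_of_nonneg h3.le]
        exact mul_lt_one_of_nonneg_of_lt_one_left h3.le h4 hz.le
      have := (hasSum_one_sub_cpow_neg a hlt).mul_left (B s)
      convert! this using 1
      · ext n
        simp only [hc]
        ring
      · simp [hz_def]
  have hint : ∀ n, ∫ s in Set.Ioi α, c n * (B s * ((1 - Real.exp (α - s) : ℝ) : ℂ) ^ n) =
      Complex.Gamma (1 + a) * Complex.Gamma (μ - a) * (ferrersCoeff a μ n * z ^ n) := by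
    intro n
    have hb := (integrableOn_beta_exp α hra (hrb n)).2
    have : ∫ s in Set.Ioi α, B s * ((1 - Real.exp (α - s) : ℝ) : ℂ) ^ n =
        Complex.betaIntegral (μ - a) (a + 1 + n) := by
      rw [← hb]
      refine setIntegral_congr_fun measurableSet_Ioi fun s hs ↦ ?_
      obtain ⟨h3, h4⟩ := one_sub_exp_mem_Ioo hs
      have h3' : ((1 - Real.exp (α - s) : ℝ) : ℂ) ≠ 0 := by exact_mod_cast h3.ne'
      simp only [hB]
      rw [show a + 1 + n - 1 = a + n by ring, Complex.cpow_add _ _ h3', Complex.cpow_natCast]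
      ring
    rw [integral_const_mul, this, Complex.betaIntegral_eq_Gamma_mul_div _ _ hra (hrb n),
      Gamma_add_nat_eq_mul_pochC (by simpa using hrb 0), hc, ferrersCoeff,
      show μ - a + (a + 1 + n) = n + 1 + μ by ring, add_comm 1 a]
    have hf : (n.factorial : ℂ) ≠ 0 := by exact_mod_cast n.factorial_ne_zero
    simp only [div_eq_mul_inv, mul_inv]
    ring
  simp only [hint] at hsum
  have hS := (summable_ferrersCoeff_mul_pow a μ hz).hasSum.mul_left
    (Complex.Gamma (1 + a) * Complex.Gamma (μ - a))
  have key := hsum.unique hS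
  have : ∫ s in Set.Ioi α, Complex.exp (-μ * s) * ((Real.sinh s - Real.sinh α : ℝ) : ℂ) ^ a =
      K * ∫ s in Set.Ioi α, B s *
        ((1 - (1 - Real.exp (α - s)) * ((1 - Real.tanh α) / 2) : ℝ) : ℂ) ^ a := by
    rw [← integral_const_mul]
    refine setIntegral_congr_fun measurableSet_Ioi fun s hs ↦ ?_
    simp only [hB, hK]
    rw [sinh_sub_sinh_cpow hs, show -μ * (s : ℂ) = -μ * α + μ * (α - s) by ring,
      show (μ - a) * ((α : ℂ) - s) = μ * (α - s) + -a * (α - s) by ring, Complex.exp_add,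
      Complex.exp_add]
    ring
  rw [this, key, hK, ferrersSeries]
  ring

theorem rpow_le_one_add_rpow {x m : ℝ} (hm : 0 < m) (hmx : m ≤ x) (hx : x ≤ 1) (l : ℝ) :
    x ^ l ≤ 1 + m ^ l := by
  have h0 : 0 < m ^ l := Real.rpow_pos_of_pos hm l
  rcases le_total 0 l with hl | hl
  · have := Real.rpow_le_one (hm.le.trans hmx) hx hl
    linarith
  · have := Real.rpow_le_rpow_of_nonpos hm hmx hl
    linarith

open MeasureTheory in
theorem integrableOn_mul_sinh_sub_sinh_cpow {f : ℝ → ℂ} {α M c : ℝ} {a : ℂ}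
    (hfc : Continuous f) (hM : 0 ≤ M) (hf : ∀ s, α < s → ‖f s‖ ≤ M * Real.exp (-c * s))
    (h1 : -1 < a.re) (h2 : a.re < c) :
    IntegrableOn (fun s ↦ f s * ((Real.sinh s - Real.sinh α : ℝ) : ℂ) ^ a) (Set.Ioi α) := by
  have hb := (integrableOn_beta_exp (a := c - a) (b := a + 1) α (by simpa using h2)
    (by simp; linarith)).1
  rw [add_sub_cancel_right] at hb
  set m := (1 + Real.tanh α) / 2 with hm_def
  have hm : 0 < m := by
    have := Real.neg_one_lt_tanh α
    rw [hm_def]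
    linarith
  have hmeas : Measurable fun s ↦ f s * ((Real.sinh s - Real.sinh α : ℝ) : ℂ) ^ a := by
    have := Real.continuous_sinh.measurable
    fun_prop
  refine Integrable.mono' ((hb.norm).const_mul
    (M * ‖((Real.cosh α : ℝ) : ℂ) ^ a‖ * (1 + m ^ a.re) * Real.exp (-c * α)))
    hmeas.aestronglyMeasurable ?_
  refine (ae_restrict_mem measurableSet_Ioi).mono fun s hs ↦ ?_
  obtain ⟨h3, h4⟩ := one_sub_mul_one_sub_tanh_mem_Ioc hs
  have hQ : ‖((1 - (1 - Real.exp (α - s)) * ((1 - Real.tanh α) / 2) : ℝ) : ℂ) ^ a‖ ≤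
      1 + m ^ a.re := by
    rw [Complex.norm_cpow_eq_rpow_re_of_pos (hm.trans_le h3)]
    exact rpow_le_one_add_rpow hm h3 h4 _
  have e1 : ‖Complex.exp (-a * (α - s))‖ = Real.exp (-a.re * (α - s)) := by
    rw [Complex.norm_exp]
    simp
  have e2 : ‖Complex.exp ((c - a) * (α - s))‖ = Real.exp ((c - a.re) * (α - s)) := by
    rw [Complex.norm_exp]
    simp
  have e3 : Real.exp (-c * s) * Real.exp (-a.re * (α - s)) =
      Real.exp (-c * α) * Real.exp ((c - a.re) * (α - s)) := by
    rw [← Real.exp_add, ← Real.exp_add]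
    ring_nf
  rw [sinh_sub_sinh_cpow hs, norm_mul, norm_mul, norm_mul, norm_mul, e1, norm_mul, e2]
  calc _ ≤ M * Real.exp (-c * s) * (‖((Real.cosh α : ℝ) : ℂ) ^ a‖ * Real.exp (-a.re * (α - s)) *
        ‖((1 - Real.exp (α - s) : ℝ) : ℂ) ^ a‖ * (1 + m ^ a.re)) := by
        gcongr
        exact hf s hs
    _ = M * (Real.exp (-c * s) * Real.exp (-a.re * (α - s))) * ‖((Real.cosh α : ℝ) : ℂ) ^ a‖ *
        ‖((1 - Real.exp (α - s) : ℝ) : ℂ) ^ a‖ * (1 + m ^ a.re) := by ring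
    _ = _ := by rw [e3]; ring

theorem continuous_jacobiP (a b : ℂ) (n : ℕ) : Continuous (jacobiP a b n) := by
  unfold jacobiP
  fun_prop

theorem continuous_jacobiKernel (μ : ℂ) (k : ℕ) : Continuous (jacobiKernel μ k) :=
  continuous_iff_continuousAt.mpr fun s ↦ (hasDerivAt_jacobiKernel μ k s).continuousAt

theorem exists_norm_jacobiKernel_le (μ : ℂ) (k : ℕ) :
    ∃ M, 0 ≤ M ∧ ∀ s, ‖jacobiKernel μ k s‖ ≤ M * Real.exp (-(μ.re + (k + 1)) * s) := by
  obtain ⟨N, hN⟩ := (isCompact_Icc (a := (-1 : ℝ)) (b := 1)).exists_bound_of_continuousOn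
    (continuous_jacobiP μ (-μ) k).continuousOn
  have hN0 : 0 ≤ N := (norm_nonneg _).trans (hN 0 (by simp))
  refine ⟨k.factorial * N * 2 ^ (k + 1), by positivity, fun s ↦ ?_⟩
  have h1 := hN (Real.tanh s) ⟨(Real.neg_one_lt_tanh s).le, (Real.tanh_lt_one s).le⟩
  have h2 : (Real.cosh s)⁻¹ ≤ 2 * Real.exp (-s) := by
    rw [inv_le_comm₀ (Real.cosh_pos s) (by positivity), mul_inv, Real.exp_neg, inv_inv,
      Real.cosh_eq]
    have := Real.exp_pos (-s)
    linarith
  have h3 : ‖jacobiKernel μ k s‖ = k.factorial * Real.exp (-μ.re * s) *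
      ‖jacobiP μ (-μ) k (Real.tanh s)‖ * ((Real.cosh s)⁻¹) ^ (k + 1) := by
    rw [jacobiKernel, norm_div, norm_mul, norm_mul, norm_mul, norm_pow, norm_pow, norm_neg,
      norm_one, one_pow, one_mul, Complex.norm_natCast, Complex.norm_exp, Complex.norm_real,
      Real.norm_of_nonneg (Real.cosh_pos s).le, div_eq_mul_inv, inv_pow]
    simp
  rw [h3]
  calc _ ≤ k.factorial * Real.exp (-μ.re * s) * N * (2 * Real.exp (-s)) ^ (k + 1) := by
        gcongr
    _ = k.factorial * N * 2 ^ (k + 1) * (Real.exp (-μ.re * s) * Real.exp (-s) ^ (k + 1)) := by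
        rw [mul_pow]
        ring
    _ = _ := by
        rw [← Real.exp_nat_mul, ← Real.exp_add]
        push_cast
        ring_nf

open MeasureTheory in
theorem integrableOn_jacobiKernel_mul_cpow {μ a : ℂ} {k : ℕ} (α : ℝ) (h1 : -1 < a.re)
    (h2 : a.re < μ.re + (k + 1)) :
    IntegrableOn (fun s ↦ jacobiKernel μ k s * ((Real.sinh s - Real.sinh α : ℝ) : ℂ) ^ a)
      (Set.Ioi α) := by
  obtain ⟨M, hM, hb⟩ := exists_norm_jacobiKernel_le μ k
  exact integrableOn_mul_sinh_sub_sinh_cpow (continuous_jacobiKernel μ k) hM (fun s _ ↦ hb s) h1 h2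

open MeasureTheory in
theorem integrableOn_cosh_mul_jacobiKernel_mul_cpow {μ a : ℂ} {k : ℕ} (α : ℝ) (h1 : -1 < a.re)
    (h2 : a.re < μ.re + k) :
    IntegrableOn (fun s ↦ ((Real.cosh s : ℝ) : ℂ) * jacobiKernel μ k s *
      ((Real.sinh s - Real.sinh α : ℝ) : ℂ) ^ a) (Set.Ioi α) := by
  obtain ⟨M, hM, hb⟩ := exists_norm_jacobiKernel_le μ k
  refine integrableOn_mul_sinh_sub_sinh_cpow (M := (1 + Real.exp (-2 * α)) / 2 * M)
    (c := μ.re + k) ?_ (by positivity) (fun s hs ↦ ?_) h1 h2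
  · have := continuous_jacobiKernel μ k
    have := Real.continuous_cosh
    fun_prop
  · have hc : Real.cosh s ≤ (1 + Real.exp (-2 * α)) / 2 * Real.exp s := by
      have : Real.exp (-s) ≤ Real.exp (-2 * α) * Real.exp s := by
        rw [← Real.exp_add]
        exact Real.exp_le_exp.mpr (by linarith)
      rw [Real.cosh_eq]
      linarith
    have he : Real.exp (-(μ.re + k) * s) = Real.exp s * Real.exp (-(μ.re + (k + 1)) * s) := by
      rw [← Real.exp_add]
      ring_nf
    rw [norm_mul, Complex.norm_real, Real.norm_of_nonneg (Real.cosh_pos s).le, he]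
    calc _ ≤ (1 + Real.exp (-2 * α)) / 2 * Real.exp s *
          (M * Real.exp (-(μ.re + (k + 1)) * s)) := by
          gcongr
          exact hb s
      _ = _ := by ring

/-- The integral of the Jacobi kernel against a power of `sinh s - sinh α`. -/
noncomputable def jacobiIntegral (α : ℝ) (μ : ℂ) (k : ℕ) (a : ℂ) : ℂ :=
  ∫ s in Set.Ioi α, ((Real.cosh s : ℝ) : ℂ) * jacobiKernel μ k s *
    ((Real.sinh s - Real.sinh α : ℝ) : ℂ) ^ a

open MeasureTheory in
/-- Integration by parts. -/
theorem add_one_mul_jacobiIntegral {μ a : ℂ} {k : ℕ} (α : ℝ) (h1 : -1 < a.re)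
    (h2 : a.re < μ.re + k) :
    (a + 1) * jacobiIntegral α μ k a = -jacobiIntegral α μ (k + 1) (a + 1) := by
  have hre : 0 < (a + 1).re := by simp; linarith
  have hne : a + 1 ≠ 0 := fun h ↦ by simp [h] at hre
  have i1 := integrableOn_cosh_mul_jacobiKernel_mul_cpow α h1 h2
  have i2 := integrableOn_cosh_mul_jacobiKernel_mul_cpow (μ := μ) (a := a + 1) (k := k + 1) α
    (by linarith) (by push_cast; simp; linarith)
  have i3 := integrableOn_jacobiKernel_mul_cpow (μ := μ) (a := a + 1) (k := k) α
    (by linarith) (by simp; linarith)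
  have hd : ∀ s ∈ Set.Ioi α, HasDerivAt
      (fun s ↦ jacobiKernel μ k s * ((Real.sinh s - Real.sinh α : ℝ) : ℂ) ^ (a + 1))
      (((Real.cosh s : ℝ) : ℂ) * jacobiKernel μ (k + 1) s *
          ((Real.sinh s - Real.sinh α : ℝ) : ℂ) ^ (a + 1) +
        (a + 1) * (((Real.cosh s : ℝ) : ℂ) * jacobiKernel μ k s *
          ((Real.sinh s - Real.sinh α : ℝ) : ℂ) ^ a)) s := by
    intro s hs
    have hpos : Real.sinh s - Real.sinh α ≠ 0 :=
      (sub_pos.mpr (Real.sinh_lt_sinh.mpr hs)).ne'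
    have hu : HasDerivAt (fun s ↦ ((Real.sinh s - Real.sinh α : ℝ) : ℂ) ^ (a + 1))
        (Real.cosh s • ((a + 1) * ((Real.sinh s - Real.sinh α : ℝ) : ℂ) ^ (a + 1 - 1))) s :=
      HasDerivAt.scomp (g₁ := fun y : ℝ ↦ (y : ℂ) ^ (a + 1)) s
        (hasDerivAt_ofReal_cpow_const hpos hne)
        ((Real.hasDerivAt_sinh s).sub_const (Real.sinh α))
    refine ((hasDerivAt_jacobiKernel μ k s).fun_mul hu).congr_deriv ?_
    rw [add_sub_cancel_right, Complex.real_smul]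
    ring
  have hcont : Continuous
      (fun s ↦ jacobiKernel μ k s * ((Real.sinh s - Real.sinh α : ℝ) : ℂ) ^ (a + 1)) :=
    (continuous_jacobiKernel μ k).mul ((Complex.continuous_ofReal_cpow_const hre).comp
      (Real.continuous_sinh.sub continuous_const))
  have i4 := i2.add (i1.const_mul (a + 1))
  have hlim := tendsto_zero_of_hasDerivAt_of_integrableOn_Ioi hd i4 i3
  have h := integral_Ioi_of_hasDerivAt_of_tendsto hcont.continuousWithinAt hd i4 hlim
  rw [integral_add i2 (i1.const_mul (a + 1)), integral_const_mul] at h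
  simp only [sub_self, Complex.ofReal_zero, Complex.zero_cpow hne, mul_zero] at h
  simp only [jacobiIntegral]
  linear_combination h

theorem sinh_mul_cpow {α s : ℝ} (hs : α < s) (a : ℂ) :
    ((Real.sinh s : ℝ) : ℂ) * ((Real.sinh s - Real.sinh α : ℝ) : ℂ) ^ a =
      ((Real.sinh α : ℝ) : ℂ) * ((Real.sinh s - Real.sinh α : ℝ) : ℂ) ^ a +
        ((Real.sinh s - Real.sinh α : ℝ) : ℂ) ^ (a + 1) := by
  have hpos : ((Real.sinh s - Real.sinh α : ℝ) : ℂ) ≠ 0 := by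
    exact_mod_cast (sub_pos.mpr (Real.sinh_lt_sinh.mpr hs)).ne'
  rw [Complex.cpow_add _ _ hpos, Complex.cpow_one]
  push_cast
  ring

open MeasureTheory in
theorem jacobiIntegral_order_sub_one {μ a : ℂ} {k : ℕ} (α : ℝ) (h1 : -1 < a.re)
    (h2 : a.re < μ.re + k) :
    jacobiIntegral α (μ - 1) (k + 1) a =
      ((Real.sinh α : ℝ) : ℂ) * jacobiIntegral α μ (k + 1) a +
        (k - a - μ) * jacobiIntegral α μ k a := by
  have i1 := integrableOn_cosh_mul_jacobiKernel_mul_cpow α h1 h2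
  have i2 := integrableOn_cosh_mul_jacobiKernel_mul_cpow (μ := μ) (a := a + 1) (k := k + 1) α
    (by simp; linarith) (by push_cast; simp; linarith)
  have i3 := integrableOn_cosh_mul_jacobiKernel_mul_cpow (μ := μ) (a := a) (k := k + 1) α
    h1 (by push_cast; linarith)
  have i4 : IntegrableOn (fun s ↦ ((Real.sinh α : ℝ) : ℂ) * (((Real.cosh s : ℝ) : ℂ) *
      jacobiKernel μ (k + 1) s * ((Real.sinh s - Real.sinh α : ℝ) : ℂ) ^ a) +
      ((Real.cosh s : ℝ) : ℂ) * jacobiKernel μ (k + 1) s *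
        ((Real.sinh s - Real.sinh α : ℝ) : ℂ) ^ (a + 1)) (Set.Ioi α) := (i3.const_mul _).add i2
  have ibp := add_one_mul_jacobiIntegral α h1 h2
  have : jacobiIntegral α (μ - 1) (k + 1) a =
      ((Real.sinh α : ℝ) : ℂ) * jacobiIntegral α μ (k + 1) a +
        jacobiIntegral α μ (k + 1) (a + 1) + (k + 1 - μ) * jacobiIntegral α μ k a := by
    simp only [jacobiIntegral]
    rw [← integral_const_mul, ← integral_const_mul, ← integral_add (i3.const_mul _) i2,
      ← integral_add i4 (i1.const_mul _)]
    refine setIntegral_congr_fun measurableSet_Ioi fun s hs ↦ ?_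
    rw [jacobiKernel_order_sub_one]
    linear_combination ((Real.cosh s : ℝ) : ℂ) * jacobiKernel μ (k + 1) s * sinh_mul_cpow hs a
  linear_combination this + ibp

open MeasureTheory in
theorem jacobiIntegral_order_add_one {μ a : ℂ} {k : ℕ} (α : ℝ) (h1 : -1 < a.re)
    (h2 : a.re < μ.re + k) :
    jacobiIntegral α (μ + 1) (k + 1) a =
      -(((Real.sinh α : ℝ) : ℂ) * jacobiIntegral α μ (k + 1) a) -
        (k - a + μ) * jacobiIntegral α μ k a := by
  have i1 := integrableOn_cosh_mul_jacobiKernel_mul_cpow α h1 h2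
  have i2 := integrableOn_cosh_mul_jacobiKernel_mul_cpow (μ := μ) (a := a + 1) (k := k + 1) α
    (by simp; linarith) (by push_cast; simp; linarith)
  have i3 := integrableOn_cosh_mul_jacobiKernel_mul_cpow (μ := μ) (a := a) (k := k + 1) α
    h1 (by push_cast; linarith)
  have i4 : IntegrableOn (fun s ↦ ((Real.sinh α : ℝ) : ℂ) * (((Real.cosh s : ℝ) : ℂ) *
      jacobiKernel μ (k + 1) s * ((Real.sinh s - Real.sinh α : ℝ) : ℂ) ^ a) +
      ((Real.cosh s : ℝ) : ℂ) * jacobiKernel μ (k + 1) s *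
        ((Real.sinh s - Real.sinh α : ℝ) : ℂ) ^ (a + 1)) (Set.Ioi α) := (i3.const_mul _).add i2
  have ibp := add_one_mul_jacobiIntegral α h1 h2
  have : jacobiIntegral α (μ + 1) (k + 1) a =
      -(((Real.sinh α : ℝ) : ℂ) * jacobiIntegral α μ (k + 1) a +
        jacobiIntegral α μ (k + 1) (a + 1) + (k + 1 + μ) * jacobiIntegral α μ k a) := by
    simp only [jacobiIntegral]
    rw [← integral_const_mul, ← integral_const_mul, ← integral_add (i3.const_mul _) i2,
      ← integral_add i4 (i1.const_mul _), ← integral_neg]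
    refine setIntegral_congr_fun measurableSet_Ioi fun s hs ↦ ?_
    rw [jacobiKernel_order_add_one]
    linear_combination -((Real.cosh s : ℝ) : ℂ) * jacobiKernel μ (k + 1) s * sinh_mul_cpow hs a
  linear_combination this - ibp

/-- The value of `jacobiIntegral`. -/
noncomputable def jacobiIntegralValue (α : ℝ) (μ : ℂ) (k : ℕ) (a : ℂ) : ℂ :=
  (-1) ^ k * Complex.Gamma (1 + a) * ((Real.cosh α : ℝ) : ℂ) ^ (a - k) *
    Complex.Gamma (μ - (a - k)) * Complex.exp (-μ * α) *
    ferrersSeries (a - k) μ (((1 - Real.tanh α) / 2 : ℝ) : ℂ)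

theorem ferrersSeries_neg_sub_one (ν μ z : ℂ) :
    ferrersSeries (-ν - 1) μ z = ferrersSeries ν μ z := by
  refine tsum_congr fun n ↦ ?_
  rw [ferrersCoeff, ferrersCoeff, sub_add_cancel, neg_sub_left, neg_neg, add_comm 1 ν,
    mul_comm (pochC (ν + 1) n)]

theorem exp_mul_ferrersSeries_order_sub_one (ν μ : ℂ) (α : ℝ) :
    Complex.exp α * ferrersSeries ν (μ - 1) (((1 - Real.tanh α) / 2 : ℝ) : ℂ) =
      ((Real.sinh α : ℝ) : ℂ) * (μ - ν - 1) *
          ferrersSeries ν μ (((1 - Real.tanh α) / 2 : ℝ) : ℂ) +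
        ((Real.cosh α : ℝ) : ℂ) * (ν + 1 + μ) *
          ferrersSeries (ν + 1) μ (((1 - Real.tanh α) / 2 : ℝ) : ℂ) := by
  have h := ferrersSeries_order_sub_one ν μ
    (z := (((1 - Real.tanh α) / 2 : ℝ) : ℂ)) (norm_one_sub_tanh_div_two_lt_one α)
  have hz : ((Real.cosh α : ℝ) : ℂ) * (1 - 2 * (((1 - Real.tanh α) / 2 : ℝ) : ℂ)) =
      ((Real.sinh α : ℝ) : ℂ) := by
    have := (Real.cosh_pos α).ne'
    norm_cast
    rw [Real.tanh_eq_sinh_div_cosh]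
    field_simp
    ring
  have hE : Complex.exp α = ((Real.cosh α : ℝ) : ℂ) + ((Real.sinh α : ℝ) : ℂ) := by
    rw [← Complex.ofReal_exp, ← Real.cosh_add_sinh]
    push_cast
    rfl
  generalize (((1 - Real.tanh α) / 2 : ℝ) : ℂ) = z at *
  rw [hE]
  linear_combination ((Real.cosh α : ℝ) : ℂ) * h - hz * ferrersSeries ν (μ - 1) z
    + hz * (μ - ν - 1) * ferrersSeries ν μ z

theorem jacobiIntegral_zero {μ a : ℂ} (α : ℝ) (h1 : -1 < a.re) (h2 : a.re < μ.re) :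
    jacobiIntegral α μ 0 a = jacobiIntegralValue α μ 0 a := by
  have : jacobiIntegral α μ 0 a = ∫ s in Set.Ioi α, Complex.exp (-μ * s) *
      ((Real.sinh s - Real.sinh α : ℝ) : ℂ) ^ a := by
    refine MeasureTheory.integral_congr_ae (.of_forall fun s ↦ ?_)
    beta_reduce
    rw [jacobiKernel_zero, mul_div_cancel₀ _ (ofReal_cosh_ne_zero s)]
  rw [this, integral_exp_mul_sinh_sub_sinh_cpow α h2 h1, jacobiIntegralValue]
  simp

theorem jacobiIntegralValue_succ {μ a : ℂ} {k : ℕ} (α : ℝ) (h : μ - 1 - (a - k) ≠ 0)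
    (h' : μ - (a - k) ≠ 0) :
    ((Real.cosh α : ℝ) : ℂ) ^ 2 * jacobiIntegralValue α μ (k + 1) a =
      -(((Real.sinh α : ℝ) : ℂ) * (k - a - μ) * jacobiIntegralValue α μ k a) -
        (k - a + (μ - 1)) * jacobiIntegralValue α (μ - 1) k a := by
  have hC := ofReal_cosh_ne_zero α
  have hS := exp_mul_ferrersSeries_order_sub_one (-(a - k) - 1) μ α
  rw [sub_add_cancel, ferrersSeries_neg_sub_one, ferrersSeries_neg_sub_one,
    ← ferrersSeries_neg_sub_one (-(a - k)), neg_neg] at hS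
  have e : a - ((k + 1 : ℕ) : ℂ) = a - k - 1 := by push_cast; ring
  have hG1 : Complex.Gamma (μ - (a - k)) = (μ - 1 - (a - k)) * Complex.Gamma (μ - 1 - (a - k)) := by
    rw [← Complex.Gamma_add_one _ h]
    ring_nf
  have hG2 : Complex.Gamma (μ - (a - k - 1)) = (μ - (a - k)) * Complex.Gamma (μ - (a - k)) := by
    rw [← Complex.Gamma_add_one _ h']
    ring_nf
  have hexp : Complex.exp (-(μ - 1) * α) = Complex.exp (-μ * α) * Complex.exp α := by
    rw [← Complex.exp_add]
    ring_nf
  have hP : ((Real.cosh α : ℝ) : ℂ) ^ (a - k) =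
      ((Real.cosh α : ℝ) : ℂ) ^ (a - k - 1) * (Real.cosh α : ℝ) := by
    rw [Complex.cpow_sub _ 1 hC, Complex.cpow_one, div_mul_cancel₀ _ hC]
  simp only [jacobiIntegralValue]
  rw [e, hG2, hG1, hexp, hP, pow_succ (-1 : ℂ)]
  linear_combination (-1) ^ k * (((Real.cosh α : ℝ) : ℂ) ^ (a - k - 1) * (Real.cosh α : ℝ)) *
    Complex.Gamma (1 + a) * (μ - 1 - (a - k)) *
    Complex.Gamma (μ - 1 - (a - k)) * Complex.exp (-μ * α) * hS

theorem jacobiIntegralValue_order_sub_one {μ a : ℂ} {k : ℕ} (α : ℝ) (h : μ - (a - k) ≠ 0) :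
    jacobiIntegralValue α (μ - 1) (k + 1) a =
      ((Real.sinh α : ℝ) : ℂ) * jacobiIntegralValue α μ (k + 1) a +
        (k - a - μ) * jacobiIntegralValue α μ k a := by
  have hC := ofReal_cosh_ne_zero α
  have hS := exp_mul_ferrersSeries_order_sub_one (a - k - 1) μ α
  rw [sub_add_cancel] at hS
  have e : a - ((k + 1 : ℕ) : ℂ) = a - k - 1 := by push_cast; ring
  have e' : μ - 1 - (a - k - 1) = μ - (a - k) := by ring
  have hG2 : Complex.Gamma (μ - (a - k - 1)) = (μ - (a - k)) * Complex.Gamma (μ - (a - k)) := by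
    rw [← Complex.Gamma_add_one _ h]
    ring_nf
  have hexp : Complex.exp (-(μ - 1) * α) = Complex.exp (-μ * α) * Complex.exp α := by
    rw [← Complex.exp_add]
    ring_nf
  have hP : ((Real.cosh α : ℝ) : ℂ) ^ (a - k) =
      ((Real.cosh α : ℝ) : ℂ) ^ (a - k - 1) * (Real.cosh α : ℝ) := by
    rw [Complex.cpow_sub _ 1 hC, Complex.cpow_one, div_mul_cancel₀ _ hC]
  simp only [jacobiIntegralValue]
  rw [e, e', hG2, hexp, hP, pow_succ (-1 : ℂ)]
  linear_combination -(-1) ^ k * ((Real.cosh α : ℝ) : ℂ) ^ (a - k - 1) * Complex.Gamma (1 + a) *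
    Complex.Gamma (μ - (a - k)) * Complex.exp (-μ * α) * hS

theorem jacobiIntegral_succ {μ a : ℂ} {k : ℕ} (α : ℝ) (h1 : -1 < a.re)
    (h2 : a.re < (μ - 1).re + k) :
    ((Real.cosh α : ℝ) : ℂ) ^ 2 * jacobiIntegral α μ (k + 1) a =
      -(((Real.sinh α : ℝ) : ℂ) * (k - a - μ) * jacobiIntegral α μ k a) -
        (k - a + (μ - 1)) * jacobiIntegral α (μ - 1) k a := by
  have hadd := jacobiIntegral_order_add_one α h1 h2
  have hsub := jacobiIntegral_order_sub_one (μ := μ) (k := k) α h1 (by simp at h2; linarith)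
  rw [sub_add_cancel] at hadd
  rw [ofReal_cosh_sq]
  linear_combination hadd - ((Real.sinh α : ℝ) : ℂ) * hsub

theorem jacobiIntegral_eq {a : ℂ} (α : ℝ) (h1 : -1 < a.re) (k : ℕ) {μ : ℂ}
    (h2 : a.re < μ.re + k) : jacobiIntegral α μ k a = jacobiIntegralValue α μ k a := by
  induction k generalizing μ with
  | zero => exact jacobiIntegral_zero α h1 (by simpa using h2)
  | succ k ih =>
    have hne {ν : ℂ} (h : a.re < ν.re + k) : ν - (a - k) ≠ 0 := fun h0 ↦ by
      have := congrArg Complex.re h0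
      simp at this
      linarith
    have hlarge {ν : ℂ} (h : a.re < (ν - 1).re + k) :
        jacobiIntegral α ν (k + 1) a = jacobiIntegralValue α ν (k + 1) a := by
      have h' : a.re < ν.re + k := by simp at h; linarith
      refine mul_left_cancel₀ (pow_ne_zero 2 (ofReal_cosh_ne_zero α)) ?_
      rw [jacobiIntegral_succ α h1 h, jacobiIntegralValue_succ α (hne h) (hne h'), ih h, ih h']
    have hdown {ν : ℂ} (h : a.re < ν.re + k)
        (hν : jacobiIntegral α ν (k + 1) a = jacobiIntegralValue α ν (k + 1) a) :
        jacobiIntegral α (ν - 1) (k + 1) a = jacobiIntegralValue α (ν - 1) (k + 1) a := by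
      rw [jacobiIntegral_order_sub_one α h1 h, jacobiIntegralValue_order_sub_one α (hne h), ih h, hν]
    push_cast at h2
    have h3 := hdown (ν := μ + 1 + 1) (by simp; linarith) (hlarge (by simp; linarith))
    rw [add_sub_cancel_right] at h3
    have h4 := hdown (by simp; linarith) h3
    rwa [add_sub_cancel_right] at h4

theorem ferrersP_neg_tanh (ν μ : ℂ) (α : ℝ) :
    ferrersP ν (-μ) (Real.tanh α) =
      Complex.exp (-μ * α) * ferrersSeries ν μ (((1 - Real.tanh α) / 2 : ℝ) : ℂ) := by
  have h : (1 + Real.tanh α) / (1 - Real.tanh α) = Real.exp (2 * α) := by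
    have hc := (Real.cosh_pos α).ne'
    have h1 : 1 + Real.tanh α = Real.exp α / Real.cosh α := by
      rw [Real.tanh_eq_sinh_div_cosh, ← Real.cosh_add_sinh]
      field_simp
    have h2 : 1 - Real.tanh α = Real.exp (-α) / Real.cosh α := by
      rw [Real.tanh_eq_sinh_div_cosh, ← Real.cosh_sub_sinh]
      field_simp
    rw [h1, h2, div_div_div_cancel_right₀ hc, ← Real.exp_sub]
    ring_nf
  rw [ferrersP, h, Complex.cpow_def_of_ne_zero (by exact_mod_cast (Real.exp_pos _).ne'),
    ← Complex.ofReal_log (Real.exp_pos _).le, Real.log_exp]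
  congr 1
  · congr 1
    push_cast
    ring
  · simp only [ferrersSeries, ferrersCoeff, sub_neg_eq_add]

theorem stmt8 (α : ℝ) (k : ℕ) (μ lam : ℂ) (h1 : lam.re < μ.re + k) (h2 : -1 < lam.re) :
    ferrersP (lam - k) (-μ) (Real.tanh α) =
      (k.factorial : ℂ) * ((Real.cosh α : ℝ) : ℂ) ^ ((k : ℂ) - lam) /
          (Complex.Gamma ((k : ℂ) + μ - lam) * Complex.Gamma (1 + lam)) *
        ∫ s in Set.Ioi α,
          Complex.exp (-μ * (s : ℂ)) * jacobiP μ (-μ) k (Real.tanh s) *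
            ((Real.sinh s - Real.sinh α : ℝ) : ℂ) ^ lam *
            ((Real.cosh s : ℝ) : ℂ) ^ (-(k : ℂ)) := by
  have hs : ((-1 : ℂ) ^ k) ^ 2 = 1 := by rw [← pow_mul, mul_comm, pow_mul]; simp
  have hk : (k.factorial : ℂ) ≠ 0 := by exact_mod_cast k.factorial_ne_zero
  have hI : ∫ s in Set.Ioi α,
      Complex.exp (-μ * (s : ℂ)) * jacobiP μ (-μ) k (Real.tanh s) *
        ((Real.sinh s - Real.sinh α : ℝ) : ℂ) ^ lam * ((Real.cosh s : ℝ) : ℂ) ^ (-(k : ℂ)) =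
      (-1) ^ k / k.factorial * jacobiIntegral α μ k lam := by
    rw [jacobiIntegral, ← MeasureTheory.integral_const_mul]
    refine MeasureTheory.integral_congr_ae (.of_forall fun s ↦ ?_)
    have hc := ofReal_cosh_ne_zero s
    beta_reduce
    rw [jacobiKernel, Complex.cpow_neg, Complex.cpow_natCast]
    field_simp
    rw [hs]
    ring
  have hC := ofReal_cosh_ne_zero α
  have hG1 : Complex.Gamma (k + μ - lam) ≠ 0 := Complex.Gamma_ne_zero_of_re_pos (by simp; linarith)
  have hG2 : Complex.Gamma (1 + lam) ≠ 0 := Complex.Gamma_ne_zero_of_re_pos (by simp; linarith)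
  have hP : ((Real.cosh α : ℝ) : ℂ) ^ (lam - k) ≠ 0 :=
    fun h ↦ hC ((Complex.cpow_eq_zero_iff _ _).mp h).1
  have e1 : (k : ℂ) - lam = -(lam - k) := by ring
  have e2 : μ - (lam - k) = k + μ - lam := by ring
  rw [hI, jacobiIntegral_eq α h2 k h1, ferrersP_neg_tanh, jacobiIntegralValue, e1,
    Complex.cpow_neg, e2]
  field_simp
  rw [hs, mul_one]
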